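/- arXiv:1509.00092 — 2 statements merged into one kernel-verified Lean document; each statement's English description precedes it below -/
import Mathlib

section
/- There exist constants c1, c2 ≥ 1 and n0 such that for every n ≥ n0 there exist positive integers u, v and subsets S_{ij} ⊆ [n] (for i ∈ [u], j ∈ [v]) with Σ_{i,j} |S_{ij}| ≤ n^{c2}, such that the monotone depth-three Boolean function f:{0,1}^n → {0,1} defined by f(x) = ⋀_{i=1}^u ⋁_{j=1}^v ⋀_{k∈S_{ij}} x_k satisfies: (i) |Pr_{x uniform on {0,1}^n}[f(x)=1] − 1/2| ≤ 1/10, and (ii) for every integer 1 ≤ q ≤ n, I_q(f) ≤ c1·((log₂ n)^2/n)·q. -/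
open Finset

/-- Probability of event `E` under the uniform distribution on a finite type. -/
noncomputable def uPr {α : Type*} [Fintype α] (E : α → Prop) : ℝ :=
  (Nat.card {x // E x} : ℝ) / (Fintype.card α)

/-- The event that `f` is not determined by the assignment `x` to coordinates outside `Q`. -/
def Undet {n : ℕ} (F : (Fin n → Bool) → Prop) (Q : Finset (Fin n)) (x : Fin n → Bool) : Prop :=
  ∃ y z : Fin n → Bool, (∀ i ∉ Q, y i = x i) ∧ (∀ i ∉ Q, z i = x i) ∧ ¬(F y ↔ F z)

/-- Monotone depth-3 (AND of ORs of ANDs) function given by subsets `S i j`. -/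
def Depth3 {n u v : ℕ} (S : Fin u → Fin v → Finset (Fin n)) (x : Fin n → Bool) : Prop :=
  ∀ i, ∃ j, ∀ k ∈ S i j, x k = true

open scoped BigOperators

section Expectation

variable {ι κ β : Type*} [Fintype ι] [Fintype κ] [Fintype β]

theorem expect_prod_fst [Nonempty κ] (F : ι → ℝ) : 𝔼 p : ι × κ, F p.1 = 𝔼 i, F i := by
  rw [← Finset.univ_product_univ, Finset.expect_product]
  simp

theorem expect_shift [AddGroup β] (F : β → ℝ) (c : β) : 𝔼 b, F (c + b) = 𝔼 b, F b :=
  Fintype.expect_equiv (Equiv.addLeft c) _ _ fun _ => rfl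

open Classical in
theorem uPr_eq_expect (P : ι → Prop) : uPr P = 𝔼 x, if P x then (1 : ℝ) else 0 := by
  rw [uPr, Fintype.expect_eq_sum_div_card, Nat.card_eq_fintype_card, Fintype.card_subtype]
  simp

theorem uPr_mono {P R : ι → Prop} (h : ∀ x, P x → R x) : uPr P ≤ uPr R := by
  classical
  rw [uPr_eq_expect, uPr_eq_expect]
  refine Finset.expect_le_expect fun x _ => ?_
  by_cases hP : P x
  · simp [hP, h x hP]
  · simp only [hP, if_false]; positivity

theorem uPr_le_one [Nonempty ι] (P : ι → Prop) : uPr P ≤ 1 := by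
  classical
  rw [uPr_eq_expect, ← Fintype.expect_one (ι := ι) (M := ℝ)]
  refine Finset.expect_le_expect fun x _ => ?_
  split_ifs <;> norm_num

theorem uPr_exists_le {P : κ → ι → Prop} : uPr (fun x => ∃ k, P k x) ≤ ∑ k, uPr (P k) := by
  classical
  simp only [uPr_eq_expect]
  rw [← Finset.expect_sum_comm]
  refine Finset.expect_le_expect fun x _ => ?_
  split_ifs with h
  · obtain ⟨k, hk⟩ := h
    have := Finset.single_le_sum (f := fun k => if P k x then (1 : ℝ) else 0)
      (fun _ _ => by positivity) (Finset.mem_univ k)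
    simpa [hk] using this
  · positivity

variable [DecidableEq ι] [DecidableEq κ]

theorem expect_pi_prod (F : ι → β → ℝ) :
    𝔼 x : ι → β, ∏ i, F i (x i) = ∏ i, 𝔼 b, F i b := by
  simp only [Fintype.expect_eq_sum_div_card, Finset.prod_div_distrib, Finset.prod_univ_sum,
    Fintype.piFinset_univ]
  simp

theorem expect_pi_eval [Nonempty β] (F : β → ℝ) (i : ι) :
    𝔼 x : ι → β, F (x i) = 𝔼 b, F b := by
  have h := expect_pi_prod (ι := ι) (fun j => if j = i then F else fun _ => 1)
  have h1 : ∀ x : ι → β, ∏ j, (if j = i then F else fun _ => 1) (x j) = F (x i) := by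
    intro x
    rw [Finset.prod_eq_single i] <;> simp +contextual
  simp only [h1] at h
  rw [h, Finset.prod_eq_single i] <;> simp +contextual

theorem expect_pi_eval_mul_eval [Nonempty β] (F G : β → ℝ) {i j : ι} (hij : i ≠ j) :
    𝔼 x : ι → β, F (x i) * G (x j) = (𝔼 b, F b) * 𝔼 b, G b := by
  have h := expect_pi_prod (ι := ι)
    (fun k => if k = i then F else if k = j then G else fun _ => 1)
  have key : ∀ f : ι → ℝ, (∀ k, k ≠ i → k ≠ j → f k = 1) → ∏ k, f k = f i * f j := by
    intro f hf
    rw [← Finset.prod_pair hij]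
    refine (Finset.prod_subset (Finset.subset_univ _) ?_).symm
    intro k _ hk
    simp only [Finset.mem_insert, Finset.mem_singleton, not_or] at hk
    exact hf k hk.1 hk.2
  rw [key _ (by intro k h1 h2; simp [h1, h2])] at h
  simp only [if_true, if_neg hij.symm] at h
  rw [← h]
  refine Finset.expect_congr rfl fun x _ => ?_
  rw [key _ (by intro k h1 h2; simp [h1, h2])]
  simp [hij.symm]

theorem expect_comp_injective [Nonempty β] {e : κ → ι} (he : Function.Injective e)
    (F : (κ → β) → ℝ) : 𝔼 x : ι → β, F (x ∘ e) = 𝔼 z : κ → β, F z := by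
  classical
  let E₁ := Equiv.piEquivPiSubtypeProd (fun i => i ∈ Set.range e) (fun _ => β)
  let E₂ : (Set.range e → β) ≃ (κ → β) := (Equiv.ofInjective e he).symm.arrowCongr (Equiv.refl β)
  rw [Fintype.expect_equiv E₁ (fun x => F (x ∘ e)) (fun p => F (E₂ p.1))]
  · rw [expect_prod_fst (fun y => F (E₂ y))]
    exact Fintype.expect_equiv E₂ _ _ fun _ => rfl
  · intro x
    congr 1

theorem expect_prod_rows (F : ι → (κ → β) → ℝ) :
    𝔼 x : ι × κ → β, ∏ i, F i (fun k => x (i, k)) = ∏ i, 𝔼 y : κ → β, F i y := by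
  rw [← expect_pi_prod]
  exact Fintype.expect_equiv (Equiv.curry ι κ β) _ _ fun _ => rfl

end Expectation

theorem exp_neg_le_one_sub {g : ℝ} (h1 : g ≤ 1 / 2) :
    Real.exp (-(g + 2 * g ^ 2)) ≤ 1 - g := by
  have h2 : 0 < 1 - g := by linarith
  rw [Real.exp_neg]
  refine inv_le_of_inv_le₀ h2 ?_
  refine le_trans ?_ (Real.add_one_le_exp _)
  rw [inv_le_iff_one_le_mul₀ h2]
  nlinarith [mul_nonneg (sq_nonneg g) (by linarith : 0 ≤ 1 - 2 * g)]

theorem exp_mul_le_prod_one_sub {V : Type*} [Fintype V] (g : V → ℝ)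
    (hg : ∀ j, (0 ≤ g j ∧ g j ≤ 1 / 2) ∨ g j = 1) {μ : ℝ} (hμ : 1 ≤ μ) :
    Real.exp (-μ) * (1 + μ - ∑ j, (g j + (1 + μ) * g j ^ 2)) ≤ ∏ j, (1 - g j) := by
  have hg0 : ∀ j, 0 ≤ g j := fun j => by rcases hg j with h | h <;> linarith
  by_cases h : ∃ j, g j = 1
  · obtain ⟨j, hj⟩ := h
    rw [Finset.prod_eq_zero (Finset.mem_univ j) (by rw [hj, sub_self])]
    refine mul_nonpos_of_nonneg_of_nonpos (Real.exp_pos _).le ?_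
    have := Finset.single_le_sum (f := fun j => g j + (1 + μ) * g j ^ 2)
      (fun j _ => by have := hg0 j; positivity) (Finset.mem_univ j)
    simp only [hj] at this
    linarith
  · push Not at h
    have h1 : Real.exp (-∑ j, (g j + 2 * g j ^ 2)) ≤ ∏ j, (1 - g j) := by
      rw [← Finset.sum_neg_distrib, Real.exp_sum]
      refine Finset.prod_le_prod (fun _ _ => (Real.exp_pos _).le) fun j _ => ?_
      have := (hg j).resolve_right (h j)
      exact exp_neg_le_one_sub this.2
    refine le_trans ?_ h1
    have h2 : ∑ j, (g j + 2 * g j ^ 2) ≤ ∑ j, (g j + (1 + μ) * g j ^ 2) :=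
      Finset.sum_le_sum fun j _ => by nlinarith [sq_nonneg (g j)]
    have h3 := Real.add_one_le_exp (μ - ∑ j, (g j + 2 * g j ^ 2))
    rw [show -∑ j, (g j + 2 * g j ^ 2) = -μ + (μ - ∑ j, (g j + 2 * g j ^ 2)) by ring, Real.exp_add]
    gcongr
    linarith

/-- The variables used by the construction: `w` columns, each made of `v` pairs. -/
abbrev Cell (w v : ℕ) := Fin w × Fin v × Bool

/-- A choice of `v` disjoint blocks, each having one cell in every column: a cyclic shift for every
column, and a choice inside every pair. -/
abbrev Pattern (w v : ℕ) := (Fin w → Fin v) × (Fin v → Fin w → Bool)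

section Pattern

variable {w v : ℕ}

/-- The cell of the `j`-th block in column `k`. -/
def Pattern.cell (T : Pattern w v) (j : Fin v) (k : Fin w) : Cell w v :=
  (k, j + T.1 k, T.2 j k)

theorem Pattern.cell_injective (T : Pattern w v) :
    Function.Injective fun p : Fin v × Fin w => T.cell p.1 p.2 := by
  rintro ⟨j, k⟩ ⟨j', k'⟩ h
  simp only [Pattern.cell, Prod.mk.injEq] at h
  obtain ⟨rfl, h, -⟩ := h
  rw [add_right_cancel h]

/-- No block of `T` is identically true. -/
def Pattern.Fails (T : Pattern w v) (x : Cell w v → Bool) : Prop :=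
  ∀ j, ∃ k, x (T.cell j k) = false

/-- The truth value as a real number. -/
def bit (b : Bool) : ℝ := if b then 1 else 0

theorem prod_bit {κ : Type*} [Fintype κ] [DecidableEq κ] (z : κ → Bool) :
    ∏ k, bit (z k) = if ∀ k, z k = true then 1 else 0 := by
  simp [bit, Finset.prod_ite_zero]

/-- The density of true cells in a pair. -/
noncomputable def pairDensity (x : Fin v × Bool → Bool) (c : Fin v) : ℝ := 𝔼 b, bit (x (c, b))

theorem pairDensity_cases (x : Fin v × Bool → Bool) (c : Fin v) :
    pairDensity x c = 0 ∨ pairDensity x c = 1 / 2 ∨ pairDensity x c = 1 := by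
  simp only [pairDensity, Fintype.expect_eq_sum_div_card, Fintype.sum_bool, bit]
  cases x (c, true) <;> cases x (c, false) <;> norm_num

theorem prod_half_or_one {κ : Type*} [DecidableEq κ] (s : Finset κ) (h : κ → ℝ)
    (hh : ∀ k, h k = 0 ∨ h k = 1 / 2 ∨ h k = 1) :
    (0 ≤ ∏ k ∈ s, h k ∧ ∏ k ∈ s, h k ≤ 1 / 2) ∨ ∏ k ∈ s, h k = 1 := by
  induction s using Finset.induction_on with
  | empty => simp
  | insert a s ha ih =>
    rw [Finset.prod_insert ha]
    rcases hh a with h0 | h0 | h0 <;> rw [h0]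
    · simp
    · left
      rcases ih with h1 | h1
      · constructor <;> linarith
      · rw [h1]; norm_num
    · simpa using ih

theorem one_sub_prod_bit (z : Fin w → Bool) :
    1 - ∏ k, bit (z k) = if ∃ k, z k = false then 1 else 0 := by
  rw [prod_bit]
  by_cases h : ∀ k, z k = true
  · simp [h]
  · rw [if_neg h, if_pos (by simpa using h)]; simp

open Classical in
theorem ite_fails_eq_prod (T : Pattern w v) (x : Cell w v → Bool) :
    (if T.Fails x then (1 : ℝ) else 0) = ∏ j, (1 - ∏ k, bit (x (T.cell j k))) := by
  simp only [one_sub_prod_bit, Finset.prod_ite_zero, Pattern.Fails]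
  by_cases h : ∀ j, ∃ k, x (T.cell j k) = false <;> simp [h]

/-- The chance that a random pattern fails at `x` is large when the expected number of true blocks
is close to `μ`. -/
theorem le_uPr_fails [NeZero v] (x : Cell w v → Bool) {μ : ℝ} (hμ : 1 ≤ μ) :
    Real.exp (-μ) * (1 + μ -
      (v * ∏ k, 𝔼 c, pairDensity (fun p => x (k, p)) c +
        (1 + μ) * (v * ∏ k, 𝔼 c, pairDensity (fun p => x (k, p)) c ^ 2))) ≤
      uPr fun T : Pattern w v => T.Fails x := by
  classical
  set h : Fin w → Fin v → ℝ := fun k => pairDensity (fun p => x (k, p)) with hh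
  have h1 : uPr (fun T : Pattern w v => T.Fails x) =
      𝔼 a : Fin w → Fin v, ∏ j, (1 - ∏ k, h k (j + a k)) := by
    rw [uPr_eq_expect, ← Finset.univ_product_univ, Finset.expect_product]
    refine Finset.expect_congr rfl fun a _ => ?_
    simp only [ite_fails_eq_prod, Pattern.cell]
    rw [expect_pi_prod (fun j (t : Fin w → Bool) => 1 - ∏ k, bit (x (k, j + a k, t k)))]
    refine Finset.prod_congr rfl fun j _ => ?_
    rw [Finset.expect_sub_distrib, Fintype.expect_one,
      expect_pi_prod (fun k b => bit (x (k, j + a k, b)))]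
    rfl
  have h2 : ∀ j : Fin v, ∀ F : Fin w → Fin v → ℝ,
      𝔼 a : Fin w → Fin v, ∏ k, F k (j + a k) = ∏ k, 𝔼 c, F k c := by
    intro j F
    rw [expect_pi_prod (fun k c => F k (j + c))]
    exact Finset.prod_congr rfl fun k _ => expect_shift _ _
  have h3 : ∀ F : Fin w → Fin v → ℝ,
      𝔼 a : Fin w → Fin v, ∑ j, ∏ k, F k (j + a k) = v * ∏ k, 𝔼 c, F k c := by
    intro F
    rw [Finset.expect_sum_comm]
    simp [h2]
  rw [h1]
  have h4 : Real.exp (-μ) * (1 + μ - (v * ∏ k, 𝔼 c, h k c + (1 + μ) * (v * ∏ k, 𝔼 c, h k c ^ 2))) =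
      𝔼 a : Fin w → Fin v, Real.exp (-μ) * (1 + μ - ∑ j, (∏ k, h k (j + a k) +
        (1 + μ) * (∏ k, h k (j + a k)) ^ 2)) := by
    rw [← Finset.mul_expect, Finset.expect_sub_distrib, Fintype.expect_const]
    simp only [Finset.sum_add_distrib, ← Finset.mul_sum, ← Finset.prod_pow]
    rw [Finset.expect_add_distrib, ← Finset.mul_expect, h3, h3 fun k c => h k c ^ 2]
  rw [h4]
  refine Finset.expect_le_expect fun a _ => ?_
  exact exp_mul_le_prod_one_sub (fun j => ∏ k, h k (j + a k))
    (fun j => prod_half_or_one _ _ fun k => pairDensity_cases _ _) hμ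

theorem pairDensity_eq (y : Fin v × Bool → Bool) (c : Fin v) :
    pairDensity y c = (bit (y (c, true)) + bit (y (c, false))) / 2 := by
  rw [pairDensity, Fintype.expect_eq_sum_div_card]
  simp

theorem expect_bit : 𝔼 b, bit b = 1 / 2 := by
  rw [Fintype.expect_eq_sum_div_card]
  simp [bit]

theorem expect_bit_eval (p : Fin v × Bool) :
    𝔼 y : Fin v × Bool → Bool, bit (y p) = 1 / 2 := by
  rw [expect_pi_eval, expect_bit]

theorem expect_bit_mul_bit {p q : Fin v × Bool} (h : p ≠ q) :
    𝔼 y : Fin v × Bool → Bool, bit (y p) * bit (y q) = 1 / 4 := by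
  rw [expect_pi_eval_mul_eval _ _ h, expect_bit]
  norm_num

theorem expect_pairDensity (c : Fin v) :
    𝔼 y : Fin v × Bool → Bool, pairDensity y c = 1 / 2 := by
  simp only [pairDensity_eq]
  rw [← Finset.expect_div, Finset.expect_add_distrib, expect_bit_eval, expect_bit_eval]
  norm_num

theorem expect_pairDensity_sq (c : Fin v) :
    𝔼 y : Fin v × Bool → Bool, pairDensity y c ^ 2 = 3 / 8 := by
  have h : ∀ y : Fin v × Bool → Bool, pairDensity y c ^ 2 =
      (bit (y (c, true)) + bit (y (c, false)) +
        2 * (bit (y (c, true)) * bit (y (c, false)))) / 4 := by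
    intro y
    rw [pairDensity_eq]
    unfold bit
    split_ifs <;> norm_num
  simp only [h]
  rw [← Finset.expect_div, Finset.expect_add_distrib, Finset.expect_add_distrib,
    ← Finset.mul_expect, expect_bit_eval, expect_bit_eval, expect_bit_mul_bit (by simp)]
  norm_num

theorem expect_pairDensity_mul {c d : Fin v} (h : c ≠ d) :
    𝔼 y : Fin v × Bool → Bool, pairDensity y c * pairDensity y d = 1 / 4 := by
  have h' : ∀ y : Fin v × Bool → Bool, pairDensity y c * pairDensity y d =
      (bit (y (c, true)) * bit (y (d, true)) + bit (y (c, true)) * bit (y (d, false)) +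
        bit (y (c, false)) * bit (y (d, true)) + bit (y (c, false)) * bit (y (d, false))) / 4 := by
    intro y
    rw [pairDensity_eq, pairDensity_eq]
    ring
  simp only [h']
  rw [← Finset.expect_div, Finset.expect_add_distrib, Finset.expect_add_distrib,
    Finset.expect_add_distrib]
  rw [expect_bit_mul_bit (by simp [h]), expect_bit_mul_bit (by simp [h]),
    expect_bit_mul_bit (by simp [h]), expect_bit_mul_bit (by simp [h])]
  norm_num

theorem expect_columnDensity [NeZero v] :
    𝔼 y : Fin v × Bool → Bool, 𝔼 c, pairDensity y c = 1 / 2 := by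
  rw [Finset.expect_comm]
  simp [expect_pairDensity]

theorem expect_columnDensity_sq [NeZero v] :
    𝔼 y : Fin v × Bool → Bool, (𝔼 c, pairDensity y c) ^ 2 = 1 / 4 * (1 + 1 / (2 * v)) := by
  have h : ∀ c d : Fin v, 𝔼 y : Fin v × Bool → Bool, pairDensity y c * pairDensity y d =
      1 / 4 + if c = d then 1 / 8 else 0 := by
    intro c d
    split_ifs with hcd
    · subst hcd
      simp only [← sq, expect_pairDensity_sq]
      norm_num
    · rw [expect_pairDensity_mul hcd, add_zero]
  simp only [sq, Fintype.expect_mul_expect]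
  rw [Finset.expect_comm]
  have hv : (v : ℝ) ≠ 0 := by exact_mod_cast NeZero.ne v
  have h2 : ∀ c : Fin v, 𝔼 y : Fin v × Bool → Bool, 𝔼 d, pairDensity y c * pairDensity y d =
      1 / 4 + 1 / 8 / v := by
    intro c
    rw [Finset.expect_comm]
    simp only [h]
    rw [Finset.expect_add_distrib, Fintype.expect_const]
    rw [Fintype.expect_eq_sum_div_card]
    simp
  simp only [h2]
  rw [Fintype.expect_const]
  field_simp
  ring

theorem expect_cell_prod (F : (Fin v × Bool → Bool) → ℝ) :
    𝔼 x : Cell w v → Bool, ∏ k, F (fun p => x (k, p)) = (𝔼 y, F y) ^ w := by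
  rw [expect_prod_rows fun _ => F]
  simp

theorem expect_prod_columnDensity_sub_sq [NeZero v] :
    𝔼 x : Cell w v → Bool,
      (v * ∏ k, 𝔼 c, pairDensity (fun p => x (k, p)) c - (v : ℝ) / 2 ^ w) ^ 2 =
    ((v : ℝ) / 2 ^ w) ^ 2 * ((1 + 1 / (2 * v)) ^ w - 1) := by
  have h : ∀ x : Cell w v → Bool,
      (v * ∏ k, 𝔼 c, pairDensity (fun p => x (k, p)) c - (v : ℝ) / 2 ^ w) ^ 2 =
      (v : ℝ) ^ 2 * ∏ k, (𝔼 c, pairDensity (fun p => x (k, p)) c) ^ 2 -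
        2 * v * (v / 2 ^ w) * ∏ k, 𝔼 c, pairDensity (fun p => x (k, p)) c +
        (v / 2 ^ w) ^ 2 := by
    intro x
    rw [Finset.prod_pow]
    ring
  simp only [h]
  rw [Finset.expect_add_distrib, Finset.expect_sub_distrib, ← Finset.mul_expect,
    ← Finset.mul_expect, Fintype.expect_const,
    expect_cell_prod fun y => (𝔼 c, pairDensity y c) ^ 2,
    expect_cell_prod fun y => 𝔼 c, pairDensity y c,
    expect_columnDensity, expect_columnDensity_sq, mul_pow, one_div_pow, one_div_pow,
    show (4 : ℝ) = 2 ^ 2 by norm_num, ← pow_mul, mul_comm 2 w, pow_mul]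
  field_simp
  ring

/-- If `U` patterns are drawn independently then, up to a small error, the probability that none of
them fails at a random point is at most `exp (-U e^{-μ} / 2)`. -/
theorem expect_one_sub_uPr_fails_pow [NeZero v] {μ : ℝ} (hμ : μ = v / 2 ^ w) (h1 : 1 ≤ μ) (U : ℕ) :
    𝔼 x : Cell w v → Bool, (1 - uPr fun T : Pattern w v => T.Fails x) ^ U ≤
      Real.exp (-(U * Real.exp (-μ) / 2)) + 16 * (μ ^ 2 * ((1 + 1 / (2 * v)) ^ w - 1)) +
        4 * ((1 + μ) * (v * (3 / 8) ^ w)) := by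
  have h2 : 𝔼 x : Cell w v → Bool, (v : ℝ) * ∏ k, 𝔼 c, pairDensity (fun p => x (k, p)) c ^ 2 =
      v * (3 / 8) ^ w := by
    rw [← Finset.mul_expect, expect_cell_prod fun y => 𝔼 c, pairDensity y c ^ 2, Finset.expect_comm]
    simp [expect_pairDensity_sq]
  rw [hμ, ← expect_prod_columnDensity_sub_sq, ← hμ, ← h2,
    ← Fintype.expect_const (ι := Cell w v → Bool) (Real.exp (-(U * Real.exp (-μ) / 2))),
    Finset.mul_expect, Finset.mul_expect, Finset.mul_expect, ← Finset.expect_add_distrib,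
    ← Finset.expect_add_distrib]
  refine Finset.expect_le_expect fun x _ => ?_
  have hp := le_uPr_fails x h1
  have hp1 := uPr_le_one fun T : Pattern w v => T.Fails x
  have hp0 : 0 ≤ uPr fun T : Pattern w v => T.Fails x := by unfold uPr; positivity
  set p := uPr fun T : Pattern w v => T.Fails x
  set A := (v : ℝ) * ∏ k, 𝔼 c, pairDensity (fun p => x (k, p)) c
  set B := (v : ℝ) * ∏ k, 𝔼 c, pairDensity (fun p => x (k, p)) c ^ 2
  have hB : 0 ≤ B := by
    refine mul_nonneg (by positivity) (Finset.prod_nonneg fun k _ => ?_)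
    exact Finset.expect_nonneg fun c _ => sq_nonneg _
  have hB' : 0 ≤ (1 + μ) * B := mul_nonneg (by linarith) hB
  by_cases h : A + (1 + μ) * B ≤ μ + 1 / 2
  · have h3 : Real.exp (-μ) / 2 ≤ p := by
      refine le_trans ?_ hp
      have := Real.exp_pos (-μ)
      nlinarith
    have h4 : (1 - p) ^ U ≤ Real.exp (-(U * Real.exp (-μ) / 2)) := by
      calc (1 - p) ^ U ≤ Real.exp (-p) ^ U := by
            refine pow_le_pow_left₀ (by linarith) ?_ U
            exact Real.one_sub_le_exp_neg p
        _ = Real.exp (U * -p) := (Real.exp_nat_mul _ _).symm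
        _ ≤ _ := by
            gcongr
            have := mul_le_mul_of_nonneg_left h3 (Nat.cast_nonneg (α := ℝ) U)
            linarith
    have := sq_nonneg (A - μ)
    linarith
  · have h5 : (1 - p) ^ U ≤ 1 := pow_le_one₀ (by linarith) (by linarith)
    have h6 := Real.exp_pos (-(U * Real.exp (-μ) / 2))
    by_cases h7 : 1 / 4 ≤ (1 + μ) * B
    · have := sq_nonneg (A - μ)
      linarith
    · have : 1 / 4 ≤ A - μ := by linarith
      nlinarith

theorem expect_bit_row : 𝔼 z : Fin w → Bool, (1 - ∏ k, bit (z k)) = 1 - (1 / 2) ^ w := by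
  rw [Finset.expect_sub_distrib, Fintype.expect_one, expect_pi_prod fun _ => bit]
  simp only [expect_bit, Finset.prod_const, Finset.card_univ, Fintype.card_fin]

theorem expect_ite_forall_notMem (D : Finset (Fin w)) :
    𝔼 z : Fin w → Bool, (if ∀ k, k ∉ D → z k = true then (1 : ℝ) else 0) = 2 ^ #D / 2 ^ w := by
  have h : ∀ z : Fin w → Bool, (if ∀ k, k ∉ D → z k = true then (1 : ℝ) else 0) =
      ∏ k, if k ∈ D then 1 else bit (z k) := by
    intro z
    have h' : ∀ k, (if k ∈ D then 1 else bit (z k)) =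
        if k ∉ D → z k = true then (1 : ℝ) else 0 := by
      intro k
      by_cases hk : k ∈ D <;> simp [hk, bit]
    simp only [h', Finset.prod_ite_zero]
    simp
  simp only [h]
  rw [expect_pi_prod fun k b => if k ∈ D then 1 else bit b]
  have h2 : ∀ k, (𝔼 b, if k ∈ D then 1 else bit b) = (if k ∈ D then 2 else 1) * (1 / 2 : ℝ) := by
    intro k
    by_cases hk : k ∈ D
    · simp [hk]
    · simp only [hk, if_false, expect_bit, one_mul]
  simp only [h2, Finset.prod_mul_distrib, Finset.prod_const, Finset.card_univ, Fintype.card_fin]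
  rw [Finset.prod_ite]
  simp [div_eq_mul_inv]

section Coalition

variable {n : ℕ} (e : Cell w v ↪ Fin n) (Q : Finset (Fin n))

/-- The columns in which the `j`-th block of `T` meets `Q`. -/
def Pattern.hits (T : Pattern w v) (j : Fin v) : Finset (Fin w) :=
  Finset.univ.filter fun k => e (T.cell j k) ∈ Q

/-- A measure of the total overlap between the blocks of `T` and `Q`. -/
def Pattern.excess (T : Pattern w v) : ℝ := ∑ j, ((2 : ℝ) ^ #(T.hits e Q j) - 1)

/-- Whether some block of `T` is true depends on the values of `x` on `Q`. -/
def Pattern.Pivots (T : Pattern w v) (x : Fin n → Bool) : Prop :=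
  ∃ i, (T.hits e Q i).Nonempty ∧ (∀ k, k ∉ T.hits e Q i → x (e (T.cell i k)) = true) ∧
    ∀ j, T.hits e Q j = ∅ → ∃ k, x (e (T.cell j k)) = false

theorem Pattern.excess_nonneg (T : Pattern w v) : 0 ≤ T.excess e Q :=
  Finset.sum_nonneg fun _ _ => sub_nonneg.2 (one_le_pow₀ (by norm_num))

theorem Pattern.card_hits_nonempty_le (T : Pattern w v) :
    #(Finset.univ.filter fun j => (T.hits e Q j).Nonempty) ≤ #Q := by
  have h : (Finset.univ.filter fun j => (T.hits e Q j).Nonempty) ⊆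
      (Finset.univ.filter fun p : Fin v × Fin w => e (T.cell p.1 p.2) ∈ Q).image Prod.fst := by
    intro j hj
    obtain ⟨k, hk⟩ := (Finset.mem_filter.1 hj).2
    exact Finset.mem_image.2 ⟨(j, k), by simpa [Pattern.hits] using hk, rfl⟩
  refine (Finset.card_le_card h).trans (Finset.card_image_le.trans ?_)
  exact Finset.card_le_card_of_injOn (fun p => e (T.cell p.1 p.2)) (fun p hp => by simpa using hp)
    (e.injective.comp T.cell_injective).injOn

theorem Pattern.excess_le (T : Pattern w v) : T.excess e Q ≤ #Q * 2 ^ w := by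
  have h : T.excess e Q ≤
      ∑ j, if (T.hits e Q j).Nonempty then (2 : ℝ) ^ w else 0 := by
    refine Finset.sum_le_sum fun j _ => ?_
    split_ifs with hj
    · have h1 : #(T.hits e Q j) ≤ w := by simpa using Finset.card_le_univ (T.hits e Q j)
      have h2 : (2 : ℝ) ^ #(T.hits e Q j) ≤ 2 ^ w := pow_le_pow_right₀ (by norm_num) h1
      linarith
    · rw [Finset.not_nonempty_iff_eq_empty.1 hj]
      simp
  refine h.trans ?_
  rw [← Finset.sum_filter, Finset.sum_const, nsmul_eq_mul]
  gcongr
  exact T.card_hits_nonempty_le e Q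

/-- The events concerning distinct blocks of a pattern are independent. -/
theorem Pattern.expect_prod_blocks (T : Pattern w v) (F : Fin v → (Fin w → Bool) → ℝ) :
    𝔼 x : Fin n → Bool, ∏ j, F j (fun k => x (e (T.cell j k))) = ∏ j, 𝔼 z, F j z := by
  rw [← expect_prod_rows F, ← expect_comp_injective (e.injective.comp T.cell_injective)]
  rfl

theorem one_sub_half_pow_le : 1 - (1 / 2 : ℝ) ^ w ≤ Real.exp (-(1 / 2 ^ w)) := by
  rw [one_div_pow]
  exact Real.one_sub_le_exp_neg _

theorem Pattern.uPr_fails_le (T : Pattern w v) {μ : ℝ} (hμ : μ = v / 2 ^ w) :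
    uPr (fun x : Fin n → Bool => T.Fails (x ∘ e)) ≤ Real.exp (-μ) := by
  classical
  rw [uPr_eq_expect]
  simp only [ite_fails_eq_prod, Function.comp]
  rw [T.expect_prod_blocks e fun _ z => 1 - ∏ k, bit (z k)]
  simp only [expect_bit_row, Finset.prod_const, Finset.card_univ, Fintype.card_fin]
  have h : 0 ≤ 1 - (1 / 2 : ℝ) ^ w := sub_nonneg.2 (pow_le_one₀ (by norm_num) (by norm_num))
  refine (pow_le_pow_left₀ h one_sub_half_pow_le v).trans ?_
  rw [← Real.exp_nat_mul, hμ]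
  apply le_of_eq
  congr 1
  ring

theorem Pattern.uPr_pivots_block_le (T : Pattern w v) {μ : ℝ} (hμ : μ = v / 2 ^ w)
    (hQ : #Q ≤ 2 ^ w) (i : Fin v) :
    uPr (fun x : Fin n → Bool => (T.hits e Q i).Nonempty ∧
      (∀ k, k ∉ T.hits e Q i → x (e (T.cell i k)) = true) ∧
        ∀ j, T.hits e Q j = ∅ → ∃ k, x (e (T.cell j k)) = false) ≤
      2 * Real.exp (1 - μ) / 2 ^ w * (2 ^ #(T.hits e Q i) - 1) := by
  classical
  have h1 : (1 : ℝ) ≤ 2 ^ #(T.hits e Q i) := one_le_pow₀ (by norm_num)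
  by_cases hi : (T.hits e Q i).Nonempty
  swap
  · simp only [hi, false_and, uPr_eq_expect, if_false, Finset.expect_const_zero]
    have := Real.exp_pos (1 - μ)
    exact mul_nonneg (by positivity) (by linarith)
  let F : Fin v → (Fin w → Bool) → ℝ := fun j z =>
    if j = i then (if ∀ k, k ∉ T.hits e Q i → z k = true then 1 else 0)
    else if T.hits e Q j = ∅ then 1 - ∏ k, bit (z k) else 1
  let G : Fin v → ℝ := fun j =>
    (if j = i then 2 ^ #(T.hits e Q i) / 2 ^ w else 1) *
      Real.exp (if T.hits e Q j = ∅ then -(1 / 2 ^ w) else 0)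
  have hF0 : ∀ j z, 0 ≤ F j z := by
    intro j z
    simp only [F, one_sub_prod_bit]
    positivity
  have hFG : ∀ j, 𝔼 z, F j z ≤ G j := by
    intro j
    by_cases hj : j = i
    · subst hj
      simp only [F, G, if_true, hi.ne_empty, if_false, expect_ite_forall_notMem, Real.exp_zero,
        mul_one, le_refl]
    · by_cases hj' : T.hits e Q j = ∅
      · simp only [F, G, hj, hj', if_true, if_false, expect_bit_row, one_mul]
        exact one_sub_half_pow_le
      · simp [F, G, hj, hj']
  have hP : uPr (fun x : Fin n → Bool => (T.hits e Q i).Nonempty ∧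
      (∀ k, k ∉ T.hits e Q i → x (e (T.cell i k)) = true) ∧
        ∀ j, T.hits e Q j = ∅ → ∃ k, x (e (T.cell j k)) = false) ≤ ∏ j, 𝔼 z, F j z := by
    rw [← T.expect_prod_blocks e F, uPr_eq_expect]
    refine Finset.expect_le_expect fun x _ => ?_
    split_ifs with hx
    · apply le_of_eq
      symm
      refine Finset.prod_eq_one fun j _ => ?_
      by_cases hj : j = i
      · subst hj
        simp only [F, if_true]
        rw [if_pos hx.2.1]
      · by_cases hj' : T.hits e Q j = ∅
        · simp only [F, hj, hj', if_true, if_false, one_sub_prod_bit]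
          rw [if_pos (hx.2.2 j hj')]
        · simp [F, hj, hj']
    · exact Finset.prod_nonneg fun j _ => hF0 _ _
  have hcard : (v : ℝ) - 2 ^ w ≤ #(Finset.univ.filter fun j => T.hits e Q j = ∅) := by
    have h2 := T.card_hits_nonempty_le e Q
    have h3 := Finset.card_filter_add_card_filter_not (s := (Finset.univ : Finset (Fin v)))
      (fun j => T.hits e Q j = ∅)
    simp only [← Finset.nonempty_iff_ne_empty, Finset.card_univ, Fintype.card_fin] at h3
    have h4 : v ≤ #(Finset.univ.filter fun j => T.hits e Q j = ∅) + 2 ^ w := by omega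
    have h5 : (v : ℝ) ≤ #(Finset.univ.filter fun j => T.hits e Q j = ∅) + 2 ^ w := by
      exact_mod_cast h4
    linarith
  have hG : ∏ j, G j ≤ 2 ^ #(T.hits e Q i) / 2 ^ w * Real.exp (1 - μ) := by
    simp only [G, Finset.prod_mul_distrib, ← Real.exp_sum]
    rw [Finset.prod_ite_eq' _ i fun _ => (2 : ℝ) ^ #(T.hits e Q i) / 2 ^ w,
      if_pos (Finset.mem_univ i), ← Finset.sum_filter, Finset.sum_const, nsmul_eq_mul, hμ]
    gcongr
    have h6 : (0 : ℝ) < 2 ^ w := by positivity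
    rw [mul_neg, mul_one_div, neg_le, neg_sub, div_sub_one h6.ne']
    gcongr
  refine hP.trans ((Finset.prod_le_prod (fun j _ => Finset.expect_nonneg fun z _ => hF0 j z)
    fun j _ => hFG j).trans (hG.trans ?_))
  have h7 : (2 : ℝ) ≤ 2 ^ #(T.hits e Q i) :=
    le_self_pow₀ (by norm_num) (Finset.card_pos.2 hi).ne'
  calc 2 ^ #(T.hits e Q i) / 2 ^ w * Real.exp (1 - μ)
      = Real.exp (1 - μ) / 2 ^ w * 2 ^ #(T.hits e Q i) := by ring
    _ ≤ Real.exp (1 - μ) / 2 ^ w * (2 * (2 ^ #(T.hits e Q i) - 1)) := by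
        gcongr
        linarith
    _ = _ := by ring

theorem Pattern.uPr_pivots_le (T : Pattern w v) {μ : ℝ} (hμ : μ = v / 2 ^ w) (hQ : #Q ≤ 2 ^ w) :
    uPr (T.Pivots e Q) ≤ 2 * Real.exp (1 - μ) / 2 ^ w * T.excess e Q := by
  refine uPr_exists_le.trans ?_
  rw [Pattern.excess, Finset.mul_sum]
  exact Finset.sum_le_sum fun i _ => T.uPr_pivots_block_le e Q hμ hQ i

/-- The terms of the depth-three formula built from the patterns `τ`. -/
def blockSets {u : ℕ} (τ : Fin u → Pattern w v) (i : Fin u) (j : Fin v) : Finset (Fin n) :=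
  Finset.univ.image fun k => e ((τ i).cell j k)

theorem depth3_blockSets {u : ℕ} (τ : Fin u → Pattern w v) (x : Fin n → Bool) :
    Depth3 (blockSets e τ) x ↔ ∀ i, ¬ (τ i).Fails (x ∘ e) := by
  simp [Depth3, blockSets, Pattern.Fails]

theorem exists_pivots_of_undet {u : ℕ} (τ : Fin u → Pattern w v) (x : Fin n → Bool)
    (h : Undet (Depth3 (blockSets e τ)) Q x) : ∃ i, (τ i).Pivots e Q x := by
  have key : ∀ y z : Fin n → Bool, (∀ i ∉ Q, y i = x i) → (∀ i ∉ Q, z i = x i) →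
      Depth3 (blockSets e τ) y → ¬ Depth3 (blockSets e τ) z → ∃ i, (τ i).Pivots e Q x := by
    intro y z hy hz hfy hfz
    rw [depth3_blockSets] at hfy hfz
    push Not at hfz
    obtain ⟨i, hi⟩ := hfz
    have hyi := hfy i
    simp only [Pattern.Fails, Function.comp, not_forall, not_exists, Bool.not_eq_false] at hyi
    obtain ⟨j, hj⟩ := hyi
    refine ⟨i, j, ?_, ?_, ?_⟩
    · by_contra hne
      rw [Finset.not_nonempty_iff_eq_empty] at hne
      obtain ⟨k, hk⟩ := hi j
      have hkQ : e ((τ i).cell j k) ∉ Q := by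
        intro hmem
        have : k ∈ (τ i).hits e Q j := by simp [Pattern.hits, hmem]
        simp [hne] at this
      have := hj k
      rw [hy _ hkQ, ← hz _ hkQ] at this
      simp [this] at hk
    · intro k hk
      rw [← hy _ (by simpa [Pattern.hits] using hk)]
      exact hj k
    · intro l hl
      obtain ⟨k, hk⟩ := hi l
      refine ⟨k, ?_⟩
      rw [← hz]
      · exact hk
      · intro hmem
        have : k ∈ (τ i).hits e Q l := by simp [Pattern.hits, hmem]
        simp [hl] at this
  obtain ⟨y, z, hy, hz, hyz⟩ := h
  by_cases hfy : Depth3 (blockSets e τ) y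
  · exact key y z hy hz hfy fun hfz => hyz (by simp [hfy, hfz])
  · exact key z y hz hy (by_contra fun hfz => hyz (by simp [hfy, hfz])) hfy

theorem expect_prod_cell [NeZero v] (Y : Cell w v → ℝ) (j : Fin v) :
    𝔼 T : Pattern w v, ∏ k, Y (T.cell j k) = ∏ k, 𝔼 c, 𝔼 b, Y (k, c, b) := by
  rw [← Finset.univ_product_univ, Finset.expect_product]
  have h1 : ∀ a : Fin w → Fin v, 𝔼 s : Fin v → Fin w → Bool,
      ∏ k, Y (Pattern.cell (a, s) j k) = ∏ k, 𝔼 b, Y (k, j + a k, b) := by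
    intro a
    simp only [Pattern.cell]
    rw [expect_pi_eval (fun t : Fin w → Bool => ∏ k, Y (k, j + a k, t k)) j,
      expect_pi_prod fun k b => Y (k, j + a k, b)]
  simp only [h1]
  rw [expect_pi_prod fun k c => 𝔼 b, Y (k, j + c, b)]
  exact Finset.prod_congr rfl fun k _ => expect_shift (fun c => 𝔼 b, Y (k, c, b)) j

theorem expect_pow_card_hits [NeZero v] (j : Fin v) :
    𝔼 T : Pattern w v, (2 : ℝ) ^ #(T.hits e Q j) =
      ∏ k, 𝔼 c, 𝔼 b, (1 + if e (k, c, b) ∈ Q then 1 else 0) := by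
  rw [← expect_prod_cell (fun p => 1 + if e p ∈ Q then (1 : ℝ) else 0) j]
  refine Finset.expect_congr rfl fun T _ => ?_
  have h' : ∀ k, (1 + if e (T.cell j k) ∈ Q then (1 : ℝ) else 0) =
      if e (T.cell j k) ∈ Q then 2 else 1 := by
    intro k
    split_ifs <;> norm_num
  simp only [h', Finset.prod_ite, Finset.prod_const, one_pow, mul_one, Pattern.hits]

theorem expect_pow_card_hits_le [NeZero v] (j : Fin v) :
    𝔼 T : Pattern w v, (2 : ℝ) ^ #(T.hits e Q j) ≤ Real.exp (#Q / (2 * v)) := by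
  rw [expect_pow_card_hits]
  have h1 : ∀ k, (𝔼 c, 𝔼 b, (1 + if e (k, c, b) ∈ Q then (1 : ℝ) else 0)) =
      1 + (∑ c, ∑ b, if e (k, c, b) ∈ Q then (1 : ℝ) else 0) / (2 * v) := by
    intro k
    simp only [Finset.expect_add_distrib, Fintype.expect_one]
    simp only [Fintype.expect_eq_sum_div_card, ← Finset.sum_div, Fintype.card_bool,
      Fintype.card_fin, div_div, Nat.cast_ofNat]
  have h2 : ∑ k, ∑ c, ∑ b, (if e (k, c, b) ∈ Q then (1 : ℝ) else 0) ≤ #Q := by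
    simp only [← Fintype.sum_prod_type']
    rw [Finset.sum_boole]
    norm_cast
    exact Finset.card_le_card_of_injOn e (fun p hp => by simpa using hp) e.injective.injOn
  calc _ ≤ ∏ k, Real.exp ((∑ c, ∑ b, if e (k, c, b) ∈ Q then (1 : ℝ) else 0) / (2 * v)) := by
        refine Finset.prod_le_prod (fun k _ => ?_) fun k _ => ?_
        · exact Finset.expect_nonneg fun c _ => Finset.expect_nonneg fun b _ => by positivity
        · rw [h1, add_comm]
          exact Real.add_one_le_exp _
    _ ≤ _ := by
        rw [← Real.exp_sum, ← Finset.sum_div]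
        gcongr

theorem expect_excess_le [NeZero v] (hQ : #Q ≤ v) :
    𝔼 T : Pattern w v, T.excess e Q ≤ #Q := by
  have hv : (0 : ℝ) < v := by exact_mod_cast Nat.pos_of_neZero v
  have hQ' : (#Q : ℝ) ≤ v := by exact_mod_cast hQ
  simp only [Pattern.excess]
  rw [Finset.expect_sum_comm]
  have h0 : (0 : ℝ) ≤ #Q / (2 * v) := by positivity
  have h1 : (#Q : ℝ) / (2 * v) ≤ 1 := by
    rw [div_le_one (by positivity)]
    linarith
  have h2 := (abs_le.1 (Real.abs_exp_sub_one_le (abs_le.2 ⟨by linarith, h1⟩))).2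
  rw [abs_of_nonneg h0] at h2
  have h3 : ∀ j : Fin v, 𝔼 T : Pattern w v, ((2 : ℝ) ^ #(T.hits e Q j) - 1) ≤ #Q / v := by
    intro j
    rw [Finset.expect_sub_distrib, Fintype.expect_one]
    have h4 := expect_pow_card_hits_le e Q j
    calc _ ≤ 2 * ((#Q : ℝ) / (2 * v)) := by linarith
      _ = _ := by field_simp
  refine (Finset.sum_le_sum fun j _ => h3 j).trans ?_
  simp only [Finset.sum_const, Finset.card_univ, Fintype.card_fin, nsmul_eq_mul]
  rw [mul_div_cancel₀ _ hv.ne']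

theorem expect_exp_excess_le [NeZero v] (hQ : #Q ≤ v) (h0 : Q.Nonempty) :
    𝔼 T : Pattern w v, Real.exp (T.excess e Q / (#Q * 2 ^ w)) ≤ Real.exp (2 / 2 ^ w) := by
  have hq : (0 : ℝ) < #Q := by exact_mod_cast Finset.card_pos.2 h0
  have h1 : ∀ T : Pattern w v, Real.exp (T.excess e Q / (#Q * 2 ^ w)) ≤
      1 + 2 / (#Q * 2 ^ w) * T.excess e Q := by
    intro T
    have h2 : 0 ≤ T.excess e Q / (#Q * 2 ^ w) := div_nonneg (T.excess_nonneg e Q) (by positivity)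
    have h3 : T.excess e Q / (#Q * 2 ^ w) ≤ 1 :=
      (div_le_one (by positivity)).2 (T.excess_le e Q)
    have h4 := (abs_le.1 (Real.abs_exp_sub_one_le (abs_le.2 ⟨by linarith, h3⟩))).2
    rw [abs_of_nonneg h2] at h4
    calc _ ≤ 1 + 2 * (T.excess e Q / (#Q * 2 ^ w)) := by linarith
      _ = _ := by ring
  refine (Finset.expect_le_expect fun T _ => h1 T).trans ?_
  rw [Finset.expect_add_distrib, Fintype.expect_one, ← Finset.mul_expect]
  calc _ ≤ 1 + 2 / (#Q * 2 ^ w) * (#Q : ℝ) := by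
        gcongr
        exact expect_excess_le e Q hQ
    _ = 2 / 2 ^ w + 1 := by
        field_simp
        ring
    _ ≤ _ := Real.add_one_le_exp _

theorem expect_uPr_forall_not_fails [NeZero v] (U : ℕ) :
    𝔼 τ : Fin U → Pattern w v, uPr (fun x : Fin n → Bool => ∀ i, ¬ (τ i).Fails (x ∘ e)) =
      𝔼 x : Cell w v → Bool, (1 - uPr fun T : Pattern w v => T.Fails x) ^ U := by
  classical
  rw [← expect_comp_injective e.injective]
  simp only [uPr_eq_expect]
  rw [Finset.expect_comm]
  refine Finset.expect_congr rfl fun x _ => ?_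
  trans 𝔼 τ : Fin U → Pattern w v, ∏ i, (1 - if (τ i).Fails (x ∘ e) then (1 : ℝ) else 0)
  · refine Finset.expect_congr rfl fun τ _ => ?_
    split_ifs with hτ
    · symm
      exact Finset.prod_eq_one fun i _ => by simp [hτ i]
    · push Not at hτ
      obtain ⟨i, hi⟩ := hτ
      exact (Finset.prod_eq_zero (Finset.mem_univ i) (by simp [hi])).symm
  · rw [expect_pi_prod fun _ (T : Pattern w v) => 1 - if T.Fails (x ∘ e) then (1 : ℝ) else 0]
    simp only [Finset.prod_const, Finset.card_univ, Fintype.card_fin, Finset.expect_sub_distrib,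
      Fintype.expect_one]

/-- Suitable patterns exist by averaging. -/
theorem exists_patterns [NeZero v] (hv : 2 ^ w ≤ v) (U : ℕ) {δ : ℝ} (hδ : δ < 1)
    (h : 𝔼 x : Cell w v → Bool, (1 - uPr fun T : Pattern w v => T.Fails x) ^ U +
      2 ^ n * Real.exp (-(U / 2 ^ w)) ≤ δ) :
    ∃ τ : Fin U → Pattern w v,
      uPr (fun x : Fin n → Bool => ∀ i, ¬ (τ i).Fails (x ∘ e)) ≤ δ ∧
      ∀ Q : Finset (Fin n), #Q ≤ 2 ^ w → ∑ i, (τ i).excess e Q ≤ 3 * U * #Q := by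
  classical
  let 𝒬 : Finset (Finset (Fin n)) := Finset.univ.filter fun Q => Q.Nonempty ∧ #Q ≤ 2 ^ w
  let g : Finset (Fin n) → (Fin U → Pattern w v) → ℝ := fun Q τ =>
    Real.exp (-(3 * U / 2 ^ w)) * ∏ i, Real.exp ((τ i).excess e Q / (#Q * 2 ^ w))
  have hg0 : ∀ Q τ, 0 ≤ g Q τ := fun Q τ => by positivity
  have hg : ∀ Q ∈ 𝒬, 𝔼 τ, g Q τ ≤ Real.exp (-(U / 2 ^ w)) := by
    intro Q hQ
    obtain ⟨hQ0, hQ1⟩ := (Finset.mem_filter.1 hQ).2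
    simp only [g]
    rw [← Finset.mul_expect,
      expect_pi_prod fun _ (T : Pattern w v) => Real.exp (T.excess e Q / (#Q * 2 ^ w))]
    simp only [Finset.prod_const, Finset.card_univ, Fintype.card_fin]
    calc _ ≤ Real.exp (-(3 * U / 2 ^ w)) * Real.exp (2 / 2 ^ w) ^ U := by
          gcongr
          exact expect_exp_excess_le e Q (hQ1.trans hv) hQ0
      _ = _ := by
          rw [← Real.exp_nat_mul, ← Real.exp_add]
          congr 1
          ring
  have hsum : ∑ Q ∈ 𝒬, 𝔼 τ, g Q τ ≤ 2 ^ n * Real.exp (-(U / 2 ^ w)) := by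
    refine (Finset.sum_le_card_nsmul _ _ _ hg).trans ?_
    rw [nsmul_eq_mul]
    gcongr
    have := Finset.card_le_univ 𝒬
    rw [Fintype.card_finset, Fintype.card_fin] at this
    exact_mod_cast this
  obtain ⟨τ, -, hτ⟩ := Finset.exists_le_of_expect_le Finset.univ_nonempty
    (a := δ) (f := fun τ : Fin U → Pattern w v =>
      uPr (fun x : Fin n → Bool => ∀ i, ¬ (τ i).Fails (x ∘ e)) + ∑ Q ∈ 𝒬, g Q τ) (by
      rw [Finset.expect_add_distrib, Finset.expect_sum_comm, expect_uPr_forall_not_fails]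
      linarith)
  have hp0 : 0 ≤ uPr (fun x : Fin n → Bool => ∀ i, ¬ (τ i).Fails (x ∘ e)) := by
    unfold uPr
    positivity
  refine ⟨τ, ?_, fun Q hQ => ?_⟩
  · have := Finset.sum_nonneg fun Q (_ : Q ∈ 𝒬) => hg0 Q τ
    linarith
  · rcases Q.eq_empty_or_nonempty with rfl | hQ0
    · simp [Pattern.excess, Pattern.hits]
    · have h1 : g Q τ ≤ ∑ Q ∈ 𝒬, g Q τ := Finset.single_le_sum (f := fun Q => g Q τ)
        (fun Q _ => hg0 Q τ) (Finset.mem_filter.2 ⟨Finset.mem_univ _, hQ0, hQ⟩)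
      have h2 : g Q τ < 1 := by linarith
      simp only [g] at h2
      rw [← Real.exp_sum, ← Real.exp_add, Real.exp_lt_one_iff, ← Finset.sum_div] at h2
      have hq : (0 : ℝ) < #Q := by exact_mod_cast Finset.card_pos.2 hQ0
      have h3 : (∑ i, (τ i).excess e Q) / (#Q * 2 ^ w) ≤ 3 * U / 2 ^ w := by linarith
      rw [div_le_div_iff₀ (by positivity) (by positivity)] at h3
      have h4 : (0 : ℝ) < 2 ^ w := by positivity
      refine le_of_mul_le_mul_right ?_ h4
      linarith

/-- A random family of patterns can be truncated so that it becomes almost balanced, while its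
resilience is inherited. -/
theorem exists_balanced_patterns [NeZero v] {μ : ℝ} (hμ : μ = v / 2 ^ w) (h3 : 3 ≤ μ) (U : ℕ)
    (h : Real.exp (-(U * Real.exp (-μ) / 2)) + 16 * (μ ^ 2 * ((1 + 1 / (2 * v)) ^ w - 1)) +
      4 * ((1 + μ) * (v * (3 / 8) ^ w)) + 2 ^ n * Real.exp (-(U / 2 ^ w)) ≤ 3 / 5) :
    ∃ u, 0 < u ∧ u ≤ U ∧ ∃ τ : Fin u → Pattern w v,
      |uPr (Depth3 (blockSets e τ)) - 1 / 2| ≤ 1 / 10 ∧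
      ∀ Q : Finset (Fin n), #Q ≤ 2 ^ w →
        uPr (Undet (Depth3 (blockSets e τ)) Q) ≤ 6 * Real.exp (1 - μ) / 2 ^ w * U * #Q := by
  classical
  have hv : 2 ^ w ≤ v := by
    have h1 : (2 : ℝ) ^ w ≤ v := by
      have h2 : (0 : ℝ) < 2 ^ w := by positivity
      rw [eq_div_iff h2.ne'] at hμ
      nlinarith
    exact_mod_cast h1
  obtain ⟨τ, hτ, hQ⟩ := exists_patterns e hv U (δ := 3 / 5) (by norm_num)
    (by linarith [expect_one_sub_uPr_fails_pow hμ (by linarith) U])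
  let P : ℕ → ℝ := fun m =>
    uPr fun x : Fin n → Bool => ∀ i : Fin U, (i : ℕ) < m → ¬ (τ i).Fails (x ∘ e)
  have hPU : P U ≤ 3 / 5 := by simpa [P] using hτ
  have hP0 : P 0 = 1 := by simp [P, uPr_eq_expect]
  have hstep : ∀ m, P m ≤ P (m + 1) + 1 / 20 := by
    intro m
    have hexp : Real.exp (-μ) ≤ 1 / 20 := by
      have h1 : Real.exp (-μ) ≤ Real.exp (-1) ^ 3 := by
        rw [← Real.exp_nat_mul]
        gcongr
        norm_num
        linarith
      have h2 := Real.exp_neg_one_lt_d9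
      have h4 : Real.exp (-1) ^ 3 ≤ (0.3678794412 : ℝ) ^ 3 := by gcongr
      exact h1.trans (h4.trans (by norm_num))
    by_cases hm : m < U
    · have h1 : P m ≤ P (m + 1) + uPr (fun x : Fin n → Bool => (τ ⟨m, hm⟩).Fails (x ∘ e)) := by
        simp only [P, uPr_eq_expect]
        rw [← Finset.expect_add_distrib]
        refine Finset.expect_le_expect fun x _ => ?_
        by_cases hx : (τ ⟨m, hm⟩).Fails (x ∘ e)
        · rw [if_pos hx]
          have : ∀ p q : Prop, (if p then (1 : ℝ) else 0) ≤ (if q then 1 else 0) + 1 := by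
            intro p q
            split_ifs <;> norm_num
          exact this _ _
        · rw [if_neg hx, add_zero]
          apply le_of_eq
          congr 1
          refine propext ⟨fun h i hi => ?_, fun h i hi => h i (by omega)⟩
          rcases Nat.lt_succ_iff_lt_or_eq.1 hi with h' | h'
          · exact h i h'
          · have : i = ⟨m, hm⟩ := Fin.ext h'
            rwa [this]
      linarith [(τ ⟨m, hm⟩).uPr_fails_le e hμ]
    · have h1 : P m = P (m + 1) := by
        simp only [P]
        congr 1
        funext x
        refine propext (forall_congr' fun i => ?_)
        have h2 : (i : ℕ) < m := by omega
        have h4 : (i : ℕ) < m + 1 := by omega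
        simp [h2, h4]
      linarith
  have hex : ∃ m, P m ≤ 3 / 5 := ⟨U, hPU⟩
  let u := Nat.find hex
  have hu : P u ≤ 3 / 5 := Nat.find_spec hex
  have huU : u ≤ U := Nat.find_min' hex hPU
  have hu0 : 0 < u := by
    rw [Nat.pos_iff_ne_zero]
    intro h0
    rw [h0, hP0] at hu
    norm_num at hu
  have hu' : 11 / 20 ≤ P u := by
    have h1 : ¬ P (u - 1) ≤ 3 / 5 := Nat.find_min hex (by omega : u - 1 < Nat.find hex)
    have h2 := hstep (u - 1)
    rw [Nat.sub_add_cancel hu0] at h2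
    linarith
  refine ⟨u, hu0, huU, fun i => τ (Fin.castLE huU i), ?_, fun Q hQw => ?_⟩
  · have h1 : uPr (Depth3 (blockSets e fun i => τ (Fin.castLE huU i))) = P u := by
      simp only [P]
      congr 1
      funext x
      rw [depth3_blockSets]
      exact propext ⟨fun h i hi => h ⟨i, hi⟩, fun h i => h (Fin.castLE huU i) i.2⟩
    rw [h1, abs_le]
    constructor <;> linarith
  · have h0 : 0 ≤ 2 * Real.exp (1 - μ) / 2 ^ w := by positivity
    calc _ ≤ uPr (fun x => ∃ i : Fin u, (τ (Fin.castLE huU i)).Pivots e Q x) :=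
          uPr_mono fun x hx => exists_pivots_of_undet e Q _ x hx
      _ ≤ ∑ i : Fin u, uPr ((τ (Fin.castLE huU i)).Pivots e Q) := uPr_exists_le
      _ ≤ ∑ i : Fin u, 2 * Real.exp (1 - μ) / 2 ^ w * (τ (Fin.castLE huU i)).excess e Q :=
          Finset.sum_le_sum fun i _ => (τ _).uPr_pivots_le e Q hμ hQw
      _ = 2 * Real.exp (1 - μ) / 2 ^ w * ∑ i : Fin u, (τ (Fin.castLE huU i)).excess e Q := by
          rw [Finset.mul_sum]
      _ ≤ 2 * Real.exp (1 - μ) / 2 ^ w * ∑ i : Fin U, (τ i).excess e Q := by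
          gcongr
          refine (Finset.sum_map Finset.univ (Fin.castLEEmb huU)
            fun i => (τ i).excess e Q).ge.trans ?_
          exact Finset.sum_le_sum_of_subset_of_nonneg (Finset.subset_univ _)
            fun i _ _ => (τ i).excess_nonneg e Q
      _ ≤ 2 * Real.exp (1 - μ) / 2 ^ w * (3 * U * #Q) := by
          gcongr
          exact hQ Q hQw
      _ = _ := by ring

theorem sum_card_blockSets_le {u : ℕ} (τ : Fin u → Pattern w v) :
    ∑ i, ∑ j, ((blockSets e τ i j).card : ℝ) ≤ u * (v * w) := by
  have h : ∀ i j, ((blockSets e τ i j).card : ℝ) ≤ w := by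
    intro i j
    have : (blockSets e τ i j).card ≤ w := by
      refine Finset.card_image_le.trans ?_
      simp
    exact_mod_cast this
  calc _ ≤ ∑ _i : Fin u, ∑ _j : Fin v, (w : ℝ) :=
        Finset.sum_le_sum fun i _ => Finset.sum_le_sum fun j _ => h i j
    _ = _ := by simp

end Coalition

end Pattern

open Filter in
theorem exists_width_bounds : ∃ w₀ : ℕ, ∀ w ≥ w₀,
    128 * ((w : ℝ) ^ 2 * (1 / 2) ^ w) ≤ 1 / 10 ∧ 288 * ((w : ℝ) ^ 2 * (3 / 4) ^ w) ≤ 1 / 10 := by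
  have h1 := tendsto_pow_const_mul_const_pow_of_abs_lt_one 2 (r := (1 / 2 : ℝ))
    (by rw [abs_of_pos] <;> norm_num)
  have h2 := tendsto_pow_const_mul_const_pow_of_abs_lt_one 2 (r := (3 / 4 : ℝ))
    (by rw [abs_of_pos] <;> norm_num)
  have h1' := (h1.const_mul 128).eventually_le_const (u := 1 / 10) (by norm_num)
  have h2' := (h2.const_mul 288).eventually_le_const (u := 1 / 10) (by norm_num)
  exact eventually_atTop.1 (h1'.and h2')

open Filter in
theorem exists_quartic_le_two_pow : ∃ L₀ : ℕ, ∀ L ≥ L₀, 256 * L ^ 4 ≤ 2 ^ L := by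
  have h1 := tendsto_pow_const_mul_const_pow_of_abs_lt_one 4 (r := (1 / 2 : ℝ))
    (by rw [abs_of_pos] <;> norm_num)
  have h1' := (h1.const_mul 256).eventually_le_const (u := 1) (by norm_num)
  obtain ⟨L₀, hL⟩ := eventually_atTop.1 h1'
  refine ⟨L₀, fun L h => ?_⟩
  have h2 := hL L h
  rw [one_div_pow, mul_one_div, ← mul_div_assoc, div_le_one (by positivity)] at h2
  exact_mod_cast h2

/-- The choice of the width `w` of the blocks in terms of the number `n` of variables, with
`L = ⌊log₂ n⌋`. -/
theorem exists_width : ∃ n₀ : ℕ, ∀ n ≥ n₀, ∃ L w : ℕ, 2 ^ L ≤ n ∧ n < 2 ^ (L + 1) ∧ 9 ≤ n ∧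
    1 ≤ w ∧ w ≤ L ∧ L ≤ 2 * w ∧ 8 * L ^ 2 * 2 ^ w ≤ n ∧ n ≤ 32 * L ^ 2 * 2 ^ w ∧
    128 * ((w : ℝ) ^ 2 * (1 / 2) ^ w) ≤ 1 / 10 ∧ 288 * ((w : ℝ) ^ 2 * (3 / 4) ^ w) ≤ 1 / 10 := by
  obtain ⟨w₀, hw₀⟩ := exists_width_bounds
  obtain ⟨L₀, hL₀⟩ := exists_quartic_le_two_pow
  refine ⟨2 ^ (L₀ + 2 * w₀ + 4), fun n hn => ?_⟩
  have hn0 : n ≠ 0 := by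
    have := Nat.two_pow_pos (L₀ + 2 * w₀ + 4)
    omega
  set L := Nat.log 2 n with hLdef
  have hL : L₀ + 2 * w₀ + 4 ≤ L := (Nat.le_log_iff_pow_le (by norm_num) hn0).2 hn
  have h1 : 2 ^ L ≤ n := Nat.pow_log_le_self 2 hn0
  have h2 : n < 2 ^ (L + 1) := Nat.lt_pow_succ_log_self (by norm_num) n
  set t := Nat.clog 2 (8 * L ^ 2) with ht
  have hL2 : 1 < 8 * L ^ 2 := by nlinarith
  have ht1 : 8 * L ^ 2 ≤ 2 ^ t := Nat.le_pow_clog (by norm_num) _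
  have ht0 : 0 < t := Nat.clog_pos (by norm_num) hL2
  have ht2 : 2 ^ t ≤ 16 * L ^ 2 := by
    have h3 := Nat.pow_pred_clog_lt_self (b := 2) (by norm_num) hL2
    rw [← ht] at h3
    have h4 : 2 ^ t = 2 * 2 ^ t.pred := by
      rw [← pow_succ', Nat.pred_eq_sub_one, Nat.sub_add_cancel ht0]
    omega
  have ht3 : 2 * t ≤ L := by
    have h3 : 2 ^ (2 * t) ≤ 2 ^ L := by
      calc 2 ^ (2 * t) = (2 ^ t) ^ 2 := by rw [mul_comm, pow_mul]
        _ ≤ (16 * L ^ 2) ^ 2 := Nat.pow_le_pow_left ht2 2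
        _ = 256 * L ^ 4 := by ring
        _ ≤ _ := hL₀ L (by omega)
    exact (Nat.pow_le_pow_iff_right (by norm_num)).1 h3
  have hpow : 2 ^ L = 2 ^ t * 2 ^ (L - t) := by
    rw [← pow_add]
    congr 1
    omega
  refine ⟨L, L - t, h1, h2, ?_, by omega, by omega, by omega, ?_, ?_, hw₀ _ (by omega)⟩
  · have : 2 ^ 4 ≤ 2 ^ L := Nat.pow_le_pow_right (by norm_num) (by omega)
    omega
  · have := Nat.mul_le_mul_right (2 ^ (L - t)) ht1
    omega
  · have := Nat.mul_le_mul_right (2 ^ (L - t)) ht2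
    rw [pow_succ] at h2
    nlinarith

theorem error_le {n L w v U : ℕ} {μ : ℝ} (hn2 : 2 ≤ n) (hn : n < 2 ^ (L + 1)) (hw : 1 ≤ w)
    (hwL : w ≤ L) (hLw : L ≤ 2 * w) (hv : (v : ℝ) = μ * 2 ^ w) (hμ : μ = 4 * L)
    (hU : 8 * Real.exp μ ≤ U)
    (h1 : 128 * ((w : ℝ) ^ 2 * (1 / 2) ^ w) ≤ 1 / 10)
    (h2 : 288 * ((w : ℝ) ^ 2 * (3 / 4) ^ w) ≤ 1 / 10) :
    Real.exp (-(U * Real.exp (-μ) / 2)) + 16 * (μ ^ 2 * ((1 + 1 / (2 * v)) ^ w - 1)) +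
      4 * ((1 + μ) * (v * (3 / 8) ^ w)) + 2 ^ n * Real.exp (-(U / 2 ^ w)) ≤ 3 / 5 := by
  have hw' : (1 : ℝ) ≤ w := by exact_mod_cast hw
  have hwL' : (w : ℝ) ≤ L := by exact_mod_cast hwL
  have hLw' : (L : ℝ) ≤ 2 * w := by exact_mod_cast hLw
  have hp : (0 : ℝ) < 2 ^ w := by positivity
  have hμ0 : 0 < μ := by rw [hμ]; linarith
  have hμw : μ ≤ 8 * w := by rw [hμ]; linarith
  have he1 : Real.exp (-2) ≤ 3 / 20 := by
    have h3 : Real.exp (-2) = Real.exp (-1) ^ 2 := by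
      rw [← Real.exp_nat_mul]
      norm_num
    have h4 := Real.exp_neg_one_lt_d9
    have h5 : Real.exp (-1) ^ 2 ≤ (0.3678794412 : ℝ) ^ 2 := by gcongr
    rw [h3]
    exact h5.trans (by norm_num)
  have t1 : Real.exp (-(U * Real.exp (-μ) / 2)) ≤ 3 / 20 := by
    refine le_trans ?_ he1
    gcongr
    have h3 := mul_le_mul_of_nonneg_right hU (Real.exp_pos (-μ)).le
    rw [mul_assoc, ← Real.exp_add, add_neg_cancel, Real.exp_zero] at h3
    linarith
  have t2 : 16 * (μ ^ 2 * ((1 + 1 / (2 * v)) ^ w - 1)) ≤ 1 / 10 := by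
    have hv1 : (w : ℝ) ≤ v := by
      rw [hv]
      have : (1 : ℝ) ≤ 2 ^ w := one_le_pow₀ (by norm_num)
      have : (w : ℝ) ≤ μ := by rw [hμ]; linarith
      nlinarith
    have hv0 : (0 : ℝ) < v := by linarith
    have h3 : (1 + 1 / (2 * (v : ℝ))) ^ w ≤ 1 + w / v := by
      have h4 : (w : ℝ) / (2 * v) ≤ 1 := by
        rw [div_le_one (by positivity)]
        linarith
      have h5 : 0 ≤ (w : ℝ) / (2 * v) := by positivity
      have h6 := (abs_le.1 (Real.abs_exp_sub_one_le (abs_le.2 ⟨by linarith, h4⟩))).2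
      rw [abs_of_nonneg h5] at h6
      calc (1 + 1 / (2 * (v : ℝ))) ^ w ≤ Real.exp (1 / (2 * v)) ^ w := by
            gcongr
            rw [add_comm]
            exact Real.add_one_le_exp _
        _ = Real.exp (w / (2 * v)) := by
            rw [← Real.exp_nat_mul]
            congr 1
            ring
        _ ≤ 1 + 2 * (w / (2 * v)) := by linarith
        _ = _ := by
            field_simp
    calc _ ≤ 16 * (μ ^ 2 * (w / v)) := by
          gcongr
          linarith
      _ = 16 * (μ * (w * (1 / 2) ^ w)) := by
          rw [hv, one_div_pow]
          field_simp
      _ ≤ 16 * (8 * w * (w * (1 / 2) ^ w)) := by gcongr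
      _ = 128 * ((w : ℝ) ^ 2 * (1 / 2) ^ w) := by ring
      _ ≤ _ := h1
  have t3 : 4 * ((1 + μ) * (v * (3 / 8) ^ w)) ≤ 1 / 10 := by
    calc _ = 4 * ((1 + μ) * (μ * (3 / 4) ^ w)) := by
          rw [hv, mul_assoc μ, ← mul_pow]
          norm_num
      _ ≤ 4 * (9 * w * (8 * w * (3 / 4) ^ w)) := by
          gcongr
          linarith
      _ = 288 * ((w : ℝ) ^ 2 * (3 / 4) ^ w) := by ring
      _ ≤ _ := h2
  have t4 : 2 ^ n * Real.exp (-(U / 2 ^ w)) ≤ 3 / 20 := by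
    have h3 : 2 * (n : ℝ) ≤ U / 2 ^ w := by
      rw [le_div_iff₀ hp]
      have h4 : (2 : ℝ) ^ (4 * L) ≤ Real.exp μ := by
        have h5 : μ = (4 * L : ℕ) * 1 := by rw [hμ]; push_cast; ring
        rw [h5, Real.exp_nat_mul]
        gcongr
        linarith [Real.add_one_le_exp 1]
      have h6 : (n : ℝ) ≤ 2 ^ (L + 1) := by exact_mod_cast hn.le
      have h7 : (2 : ℝ) ^ w ≤ 2 ^ L := pow_le_pow_right₀ (by norm_num) hwL
      calc 2 * (n : ℝ) * 2 ^ w ≤ 2 * 2 ^ (L + 1) * 2 ^ L := by gcongr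
        _ = 4 * 2 ^ (2 * L) := by ring
        _ ≤ 8 * 2 ^ (4 * L) := by
            gcongr <;> norm_num
        _ ≤ 8 * Real.exp μ := by gcongr
        _ ≤ _ := hU
    have hn2' : (2 : ℝ) ≤ n := by exact_mod_cast hn2
    calc _ ≤ Real.exp 1 ^ n * Real.exp (-(2 * n)) := by
          gcongr
          linarith [Real.add_one_le_exp 1]
      _ = Real.exp (-n) := by
          rw [← Real.exp_nat_mul, ← Real.exp_add]
          congr 1
          ring
      _ ≤ Real.exp (-2) := by gcongr
      _ ≤ _ := he1
  linarith

theorem statement0 :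
    ∃ c1 c2 : ℝ, 1 ≤ c1 ∧ 1 ≤ c2 ∧ ∃ n0 : ℕ, ∀ n : ℕ, n0 ≤ n →
      ∃ u v : ℕ, 0 < u ∧ 0 < v ∧ ∃ S : Fin u → Fin v → Finset (Fin n),
        ((∑ i, ∑ j, ((S i j).card : ℝ)) ≤ (n : ℝ) ^ c2) ∧
        |uPr (Depth3 S) - 1/2| ≤ 1/10 ∧
        (∀ q : ℕ, 1 ≤ q → q ≤ n → ∀ Q : Finset (Fin n), Q.card ≤ q →
          uPr (Undet (Depth3 S) Q) ≤ c1 * ((Real.logb 2 n)^2 / n) * q) := by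
  obtain ⟨n₀, hn₀⟩ := exists_width
  refine ⟨5184, (10 : ℕ), by norm_num, by norm_num, n₀, fun n hn => ?_⟩
  obtain ⟨L, w, hLn, hnL, hn9, hw, hwL, hLw, hwn, hnw, hb1, hb2⟩ := hn₀ n hn
  have hL : 1 ≤ L := hw.trans hwL
  have hv0 : 0 < 4 * L * 2 ^ w := by positivity
  obtain ⟨v, hv⟩ : ∃ v, v = 4 * L * 2 ^ w := ⟨_, rfl⟩
  rw [← hv] at hv0
  have : NeZero v := ⟨hv0.ne'⟩
  obtain ⟨μ, hμ⟩ : ∃ μ : ℝ, μ = 4 * L := ⟨_, rfl⟩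
  have hL' : (1 : ℝ) ≤ L := by exact_mod_cast hL
  have hp : (0 : ℝ) < 2 ^ w := by positivity
  have hvμ : (v : ℝ) = μ * 2 ^ w := by rw [hv, hμ]; push_cast; ring
  have hvw : w * (v * 2) ≤ n := by
    calc w * (v * 2) ≤ L * (v * 2) := Nat.mul_le_mul_right _ hwL
      _ = 8 * L ^ 2 * 2 ^ w := by rw [hv]; ring
      _ ≤ n := hwn
  obtain ⟨e⟩ : Nonempty (Cell w v ↪ Fin n) :=
    Function.Embedding.nonempty_of_card_le (by simpa using hvw)
  obtain ⟨U, hU⟩ : ∃ U, U = ⌈8 * Real.exp μ⌉₊ := ⟨_, rfl⟩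
  have hU1 : 8 * Real.exp μ ≤ U := by rw [hU]; exact Nat.le_ceil _
  have hU2 : (U : ℝ) ≤ 9 * Real.exp μ := by
    have h1 := (Nat.ceil_lt_add_one (by positivity : 0 ≤ 8 * Real.exp μ)).le
    rw [← hU] at h1
    have h2 := Real.one_le_exp (x := μ) (by rw [hμ]; linarith)
    linarith
  obtain ⟨u, hu, huU, τ, hbal, hres⟩ := exists_balanced_patterns e
    (by rw [hvμ]; field_simp) (by rw [hμ]; linarith) U
    (error_le (by omega) hnL hw hwL hLw hvμ hμ hU1 hb1 hb2)
  have hn0 : (0 : ℝ) < n := by exact_mod_cast (by omega : 0 < n)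
  refine ⟨u, v, hu, hv0, blockSets e τ, ?_, hbal, ?_⟩
  · have hexp : Real.exp μ ≤ (n : ℝ) ^ 8 := by
      have h1 : μ = (4 * L : ℕ) * 1 := by rw [hμ]; push_cast; ring
      have h2 : (2 : ℝ) ^ L ≤ n := by exact_mod_cast hLn
      calc Real.exp μ = Real.exp 1 ^ (4 * L) := by rw [h1, Real.exp_nat_mul]
        _ ≤ (2 ^ 2) ^ (4 * L) := by
            gcongr
            linarith [Real.exp_one_lt_d9]
        _ = (2 ^ L) ^ 8 := by
          rw [← pow_mul, ← pow_mul]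
          congr 1
          ring
        _ ≤ _ := by gcongr
    have h9 : (9 : ℝ) ≤ n := by exact_mod_cast hn9
    have hvw' : (v : ℝ) * w ≤ n := by
      have : v * w ≤ n := by nlinarith
      exact_mod_cast this
    have huU' : (u : ℝ) ≤ U := by exact_mod_cast huU
    rw [Real.rpow_natCast]
    calc _ ≤ (u : ℝ) * (v * w) := sum_card_blockSets_le e τ
      _ ≤ (n * (n : ℝ) ^ 8) * n := by
          gcongr
          exact huU'.trans (hU2.trans (by gcongr))
      _ = _ := by ring
  · intro q hq _ Q hQ
    have hlog : (L : ℝ) ≤ Real.logb 2 n := by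
      rw [Real.le_logb_iff_rpow_le (by norm_num) hn0, Real.rpow_natCast]
      exact_mod_cast hLn
    have hkey : 1 / 2 ^ w ≤ 32 * ((Real.logb 2 n) ^ 2 / n) := by
      have h1 : (n : ℝ) ≤ 32 * L ^ 2 * 2 ^ w := by exact_mod_cast hnw
      have h2 : (L : ℝ) ^ 2 ≤ Real.logb 2 n ^ 2 := by gcongr
      rw [← mul_div_assoc, div_le_div_iff₀ hp hn0, one_mul]
      refine h1.trans ?_
      gcongr
    have hr : 0 ≤ (Real.logb 2 n) ^ 2 / n := by positivity
    have hQ' : (#Q : ℝ) ≤ q := by exact_mod_cast hQ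
    by_cases hQw : #Q ≤ 2 ^ w
    · calc _ ≤ 6 * Real.exp (1 - μ) / 2 ^ w * U * #Q := hres Q hQw
        _ ≤ 6 * Real.exp (1 - μ) / 2 ^ w * (9 * Real.exp μ) * q := by gcongr
        _ = 54 * (Real.exp (1 - μ) * Real.exp μ) * (1 / 2 ^ w) * q := by ring
        _ = 54 * Real.exp 1 * (1 / 2 ^ w) * q := by rw [← Real.exp_add, sub_add_cancel]
        _ ≤ 54 * 3 * (32 * ((Real.logb 2 n) ^ 2 / n)) * q := by
            gcongr
            linarith [Real.exp_one_lt_d9]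
        _ = _ := by ring
    · refine (uPr_le_one _).trans ?_
      have hqw : (2 : ℝ) ^ w ≤ q := by
        refine le_trans ?_ hQ'
        exact_mod_cast (not_le.1 hQw).le
      calc (1 : ℝ) = 1 / 2 ^ w * 2 ^ w := by field_simp
        _ ≤ 32 * ((Real.logb 2 n) ^ 2 / n) * q := by gcongr
        _ ≤ _ := by gcongr; norm_num
end

section
/- There exist constants C1, C2 ≥ 1 such that for every real 0 < μ ≤ 1 and all integers v ≥ 4 and w ≥ 3, there exist an integer r with r ≤ C1·(w + log₂ v + w·(log₂ log₂ v + log₂(1/μ))/log₂ w) and a function G:{0,1}^r → [v]^w with the following property: for all functions f_1,…,f_w:[v] → [0,1] with Σ_{i=1}^w E_{x uniform on [v]}[f_i(x)] = μ, one has E_{y uniform on {0,1}^r}[ 2^{Σ_{i=1}^w f_i(G(y)_i)} ] ≤ 1 + C2·μ. -/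
open Finset

/-- Every function that is affine in each coordinate and nonnegative on the vertices of the unit
cube is nonnegative on the whole cube. -/
theorem nonneg_on_cube_of_affine {ι : Type*} [Fintype ι] [DecidableEq ι] (Φ : (ι → ℝ) → ℝ)
    (haff : ∀ f p, Φ f = (1 - f p) * Φ (Function.update f p 0)
      + f p * Φ (Function.update f p 1))
    (hvert : ∀ F : ι → Bool, 0 ≤ Φ (fun p => if F p then 1 else 0))
    (f : ι → ℝ) (hf : ∀ p, 0 ≤ f p ∧ f p ≤ 1) : 0 ≤ Φ f := by
  have key : ∀ s : Finset ι, ∀ g : ι → ℝ, (∀ p, 0 ≤ g p ∧ g p ≤ 1) →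
      (∀ p, p ∉ s → g p = 0 ∨ g p = 1) → 0 ≤ Φ g := by
    intro s
    induction s using Finset.induction_on with
    | empty =>
      intro g _ hg
      have h : g = fun p => if decide (g p = 1) then (1 : ℝ) else 0 := by
        funext p
        rcases hg p (by simp) with h | h <;> simp [h]
      rw [h]
      exact hvert fun p => decide (g p = 1)
    | insert a s _ ih =>
      intro g hg hgs
      have hupd : ∀ c : ℝ, c = 0 ∨ c = 1 → 0 ≤ Φ (Function.update g a c) := by
        intro c hc
        apply ih
        · intro p
          rcases eq_or_ne p a with rfl | hp
          · rcases hc with rfl | rfl <;> simp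
          · simpa [hp] using hg p
        · intro p hp
          rcases eq_or_ne p a with rfl | hpa
          · simpa using hc
          · simpa [hpa] using hgs p (by simp [hp, hpa])
      rw [haff g a]
      exact add_nonneg (mul_nonneg (sub_nonneg.2 (hg a).2) (hupd 0 (Or.inl rfl)))
        (mul_nonneg (hg a).1 (hupd 1 (Or.inr rfl)))
  exact key univ f hf fun p hp => absurd (mem_univ p) hp

/-- A product over rows of affine forms, each in the entries of its own row, is affine in each
entry. -/
theorem prod_row_affine {α β : Type*} [Fintype α] [Fintype β] [DecidableEq α] [DecidableEq β]
    (c : α → β → ℝ) (f : α × β → ℝ) (p : α × β) :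
    ∏ i, (1 + ∑ x, c i x * f (i, x)) =
      (1 - f p) * ∏ i, (1 + ∑ x, c i x * Function.update f p 0 (i, x))
      + f p * ∏ i, (1 + ∑ x, c i x * Function.update f p 1 (i, x)) := by
  obtain ⟨a, b⟩ := p
  have hrow : ∀ t : ℝ, ∏ i, (1 + ∑ x, c i x * Function.update f (a, b) t (i, x)) =
      (1 + (c a b * t + ∑ x ∈ univ.erase b, c a x * f (a, x))) *
        ∏ i ∈ univ.erase a, (1 + ∑ x, c i x * f (i, x)) := by
    intro t
    rw [← mul_prod_erase univ _ (mem_univ a), ← add_sum_erase univ _ (mem_univ b)]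
    congr 1
    · congr 2
      · simp
      · refine sum_congr rfl fun x hx => ?_
        rw [Function.update_of_ne]
        simpa using ne_of_mem_erase hx
    · refine prod_congr rfl fun i hi => ?_
      congr 1
      refine sum_congr rfl fun x _ => ?_
      rw [Function.update_of_ne]
      have := ne_of_mem_erase hi
      simp [this]
  have h := hrow (f (a, b))
  rw [Function.update_eq_self] at h
  rw [h, hrow 0, hrow 1]
  ring

/-- Sampling: for finitely many bounded nonnegative functions on a finite space there is a sample
on which all empirical sums are at most twice their expectation plus a logarithmic error. -/
theorem exists_sample_sum_le {Y Ω ι : Type*} [Fintype Y] [Fintype Ω] [Nonempty Ω]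
    [Fintype ι] [Nonempty ι] (X : ι → Ω → ℝ) (M : ℝ) (hM : 0 < M)
    (hX : ∀ F ω, 0 ≤ X F ω ∧ X F ω ≤ M) :
    ∃ G : Y → Ω, ∀ F, ∑ y, X F (G y) ≤
      2 * Fintype.card Y * ((∑ ω, X F ω) / Fintype.card Ω) + M * Real.log (Fintype.card ι) := by
  classical
  by_contra! hcon
  have hΩ : (0 : ℝ) < Fintype.card Ω := by exact_mod_cast Fintype.card_pos
  have hι : (0 : ℝ) < Fintype.card ι := by exact_mod_cast Fintype.card_pos
  set m : ι → ℝ := fun F => (∑ ω, X F ω) / Fintype.card Ω with hm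
  let E : ι → (Y → Ω) → ℝ := fun F G =>
    Real.exp (-(2 * Fintype.card Y * m F / M)) * ∏ y, Real.exp (X F (G y) / M)
  have hlow : ∀ G, (Fintype.card ι : ℝ) < ∑ F, E F G := by
    intro G
    obtain ⟨F, hF⟩ := hcon G
    have h1 : (Fintype.card ι : ℝ) < E F G := by
      simp only [E]
      rw [← Real.exp_sum, ← Real.exp_add, ← Real.log_lt_iff_lt_exp hι, ← sum_div, neg_add_eq_sub,
        ← sub_div, lt_div_iff₀ hM]
      linarith
    refine h1.trans_le (single_le_sum (f := fun F => E F G) (fun F _ => ?_) (mem_univ F))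
    positivity
  have hup : ∀ F, ∑ G, E F G ≤ (Fintype.card Ω : ℝ) ^ Fintype.card Y := by
    intro F
    have hexp : ∑ ω, Real.exp (X F ω / M) ≤ Fintype.card Ω * Real.exp (2 * m F / M) := by
      calc ∑ ω, Real.exp (X F ω / M) ≤ ∑ ω, (1 + 2 * (X F ω / M)) := by
            refine sum_le_sum fun ω _ => ?_
            have h0 : 0 ≤ X F ω / M := div_nonneg (hX F ω).1 hM.le
            have h1 : X F ω / M ≤ 1 := (div_le_one hM).2 (hX F ω).2
            have h2 := Real.abs_exp_sub_one_le (x := X F ω / M) (by rwa [abs_of_nonneg h0])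
            rw [abs_of_nonneg h0] at h2
            linarith [le_abs_self (Real.exp (X F ω / M) - 1)]
        _ = Fintype.card Ω * (2 * m F / M + 1) := by
            rw [sum_add_distrib, ← mul_sum, ← sum_div]
            simp only [hm, sum_const, card_univ, nsmul_eq_mul]
            field_simp
            ring
        _ ≤ _ := by gcongr; exact Real.add_one_le_exp _
    have hprod : ∑ G : Y → Ω, ∏ y, Real.exp (X F (G y) / M)
        = (∑ ω, Real.exp (X F ω / M)) ^ Fintype.card Y := by
      rw [← Fintype.prod_sum fun (_ : Y) ω => Real.exp (X F ω / M)]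
      simp
    rw [← mul_sum, hprod]
    calc _ ≤ Real.exp (-(2 * Fintype.card Y * m F / M)) *
          (Fintype.card Ω * Real.exp (2 * m F / M)) ^ Fintype.card Y := by gcongr
      _ = _ := by
          rw [mul_pow, ← Real.exp_nat_mul, mul_left_comm, ← Real.exp_add]
          rw [show -(2 * Fintype.card Y * m F / M) + Fintype.card Y * (2 * m F / M) = 0 by ring]
          simp
  have h1 : ∑ _G : Y → Ω, (Fintype.card ι : ℝ) < ∑ G, ∑ F, E F G :=
    sum_lt_sum_of_nonempty univ_nonempty fun G _ => hlow G
  rw [sum_comm] at h1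
  have h2 := h1.trans_le (sum_le_sum fun F _ => hup F)
  simp [mul_comm] at h2

/-- A sample in a finite product space whose average of any product of affine factors is controlled
by the product of the means. -/
theorem exists_sample_prod_le {Y α β : Type*} [Fintype Y] [Fintype α] [Fintype β] [Nonempty β]
    [DecidableEq α] [DecidableEq β] :
    ∃ G : Y → α → β, ∀ f : α → β → ℝ, (∀ i x, 0 ≤ f i x ∧ f i x ≤ 1) →
      ∑ y, ∏ i, (1 + f i (G y i)) ≤
        Fintype.card Y * (2 * ∏ i, (1 + (∑ x, f i x) / Fintype.card β) - 1) +
          2 ^ Fintype.card α * (Fintype.card α * Fintype.card β) := by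
  have hβ : (0 : ℝ) < Fintype.card β := by exact_mod_cast Fintype.card_pos
  let b : (α × β → Bool) → α × β → ℝ := fun F p => if F p then 1 else 0
  have hb : ∀ F p, 0 ≤ b F p ∧ b F p ≤ 1 := by
    intro F p
    simp only [b]
    split_ifs <;> norm_num
  obtain ⟨G, hG⟩ := exists_sample_sum_le (Y := Y)
    (fun (F : α × β → Bool) (ω : α → β) => ∏ i, (1 + b F (i, ω i)) - 1)
    (2 ^ Fintype.card α) (by positivity) (by
      intro F ω
      constructor
      · have : 1 ≤ ∏ i, (1 + b F (i, ω i)) :=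
          Finset.one_le_prod fun i _ => by linarith [(hb F (i, ω i)).1]
        linarith
      · have : ∏ i, (1 + b F (i, ω i)) ≤ ∏ _i : α, (2 : ℝ) :=
          prod_le_prod (fun i _ => by linarith [(hb F (i, ω i)).1])
            fun i _ => by linarith [(hb F (i, ω i)).2]
        simp only [prod_const, card_univ] at this
        linarith)
  refine ⟨G, fun f hf => ?_⟩
  let K : ℝ := 2 ^ Fintype.card α * (Fintype.card α * Fintype.card β)
  let Φ : (α × β → ℝ) → ℝ := fun g =>
    2 * Fintype.card Y * ∏ i, (1 + ∑ x, (Fintype.card β : ℝ)⁻¹ * g (i, x))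
      + (K - Fintype.card Y) - ∑ y, ∏ i, (1 + ∑ x, (if G y i = x then 1 else 0) * g (i, x))
  have key : 0 ≤ Φ fun p => f p.1 p.2 := by
    apply nonneg_on_cube_of_affine
    · intro g p
      simp only [Φ]
      rw [prod_row_affine (fun _ _ => (Fintype.card β : ℝ)⁻¹) g p,
        sum_congr rfl fun y _ => prod_row_affine (fun i x => if G y i = x then 1 else 0) g p,
        sum_add_distrib, ← mul_sum, ← mul_sum]
      ring
    · intro F
      have h := hG F
      have hlog : Real.log (Fintype.card (α × β → Bool)) ≤ Fintype.card α * Fintype.card β := by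
        rw [Fintype.card_fun, Fintype.card_bool, Fintype.card_prod]
        push_cast
        rw [Real.log_pow]
        push_cast
        exact mul_le_of_le_one_right (by positivity) (by linarith [Real.log_two_lt_d9])
      have hmean : (∑ ω : α → β, (∏ i, (1 + b F (i, ω i)) - 1)) / Fintype.card (α → β)
          = ∏ i, (1 + ∑ x, (Fintype.card β : ℝ)⁻¹ * b F (i, x)) - 1 := by
        rw [sum_sub_distrib, ← Fintype.prod_sum fun i x => 1 + b F (i, x)]
        simp only [sum_add_distrib, sum_const, card_univ, nsmul_eq_mul, mul_one, Fintype.card_fun,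
          Nat.cast_pow, ← mul_sum]
        rw [sub_div, div_self (by positivity), ← card_univ (α := α), ← prod_const,
          ← prod_div_distrib]
        congr 1
        refine prod_congr rfl fun i _ => ?_
        field_simp
      rw [hmean, sum_sub_distrib] at h
      simp only [sum_const, card_univ, nsmul_eq_mul, mul_one] at h
      have h2 := mul_le_mul_of_nonneg_left hlog
        (by positivity : (0 : ℝ) ≤ 2 ^ Fintype.card α)
      simp only [Φ, K, ite_mul, one_mul, zero_mul, sum_ite_eq, mem_univ, if_true]
      simp only [b] at h
      linarith
    · exact fun p => hf p.1 p.2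
  simp only [Φ, K, ite_mul, one_mul, zero_mul, sum_ite_eq, mem_univ, if_true, ← mul_sum] at key
  simp only [div_eq_inv_mul]
  linarith

theorem statement2 :
    ∃ C1 C2 : ℝ, 1 ≤ C1 ∧ 1 ≤ C2 ∧
      ∀ (μ : ℝ), 0 < μ → μ ≤ 1 → ∀ v w : ℕ, 4 ≤ v → 3 ≤ w →
        ∃ r : ℕ, ((r : ℝ) ≤ C1 * (w + Real.logb 2 v +
            w * (Real.logb 2 (Real.logb 2 v) + Real.logb 2 (1/μ)) / Real.logb 2 w)) ∧
          ∃ G : (Fin r → Bool) → Fin w → Fin v,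
            ∀ f : Fin w → Fin v → ℝ, (∀ i x, 0 ≤ f i x ∧ f i x ≤ 1) →
              (∑ i, (∑ x, f i x) / v) = μ →
              (∑ y : Fin r → Bool, (2:ℝ) ^ (∑ i, f i (G y i))) / (2:ℝ)^r ≤ 1 + C2 * μ := by
  refine ⟨3, 5, by norm_num, by norm_num, fun μ hμ hμ1 v w hv hw => ?_⟩
  have hv' : (4 : ℝ) ≤ v := by exact_mod_cast hv
  have hw' : (3 : ℝ) ≤ w := by exact_mod_cast hw
  have hv0 : (0 : ℝ) < v := by linarith
  have hw0 : (0 : ℝ) < w := by linarith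
  have : Nonempty (Fin v) := ⟨⟨0, by lia⟩⟩
  have hlw : 0 < Real.logb 2 w := Real.logb_pos (by norm_num) (by linarith)
  have hlww : Real.logb 2 w ≤ w := by
    rw [Real.logb_le_iff_le_rpow (by norm_num) hw0, Real.rpow_natCast]
    exact_mod_cast Nat.lt_two_pow_self.le
  have hlv : 1 ≤ Real.logb 2 v := by
    rw [Real.le_logb_iff_rpow_le (by norm_num) hv0]
    norm_num
    linarith
  have hllv : 0 ≤ Real.logb 2 (Real.logb 2 v) := Real.logb_nonneg (by norm_num) hlv
  have hlμ : 0 ≤ Real.logb 2 (1 / μ) :=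
    Real.logb_nonneg (by norm_num) (by rwa [le_div_iff₀ hμ, one_mul])
  set L := Real.logb 2 w + Real.logb 2 v + Real.logb 2 (1 / μ) with hL
  have hceil : (⌈L⌉₊ : ℝ) < L + 1 := Nat.ceil_lt_add_one (by linarith)
  refine ⟨w + ⌈L⌉₊, ?_, ?_⟩
  · have h : Real.logb 2 (1 / μ) ≤
        w * (Real.logb 2 (Real.logb 2 v) + Real.logb 2 (1 / μ)) / Real.logb 2 w := by
      rw [le_div_iff₀ hlw]
      nlinarith
    push_cast
    linarith
  obtain ⟨G, hG⟩ := exists_sample_prod_le (Y := Fin (w + ⌈L⌉₊) → Bool) (α := Fin w) (β := Fin v)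
  refine ⟨G, fun f hf hsum => ?_⟩
  have hseed : (2 : ℝ) ^ w * (w * v) ≤ 2 ^ (w + ⌈L⌉₊) * μ := by
    have h1 : w * v * (1 / μ) ≤ (2 : ℝ) ^ ⌈L⌉₊ := by
      rw [← Real.rpow_natCast, ← Real.logb_le_iff_le_rpow (by norm_num) (by positivity),
        Real.logb_mul (by positivity) (by positivity), Real.logb_mul hw0.ne' hv0.ne']
      exact Nat.le_ceil L
    have h2 : (w : ℝ) * v ≤ 2 ^ ⌈L⌉₊ * μ := by
      rwa [mul_one_div, div_le_iff₀ hμ] at h1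
    rw [pow_add, mul_assoc]
    gcongr
  have hmean : ∏ i, (1 + (∑ x, f i x) / (v : ℝ)) ≤ 1 + 2 * μ := by
    calc ∏ i, (1 + (∑ x, f i x) / (v : ℝ)) ≤ ∏ i, Real.exp ((∑ x, f i x) / v) := by
          refine prod_le_prod (fun i _ => ?_) fun i _ => ?_
          · have := sum_nonneg fun x (_ : x ∈ univ) => (hf i x).1
            positivity
          · rw [add_comm]
            exact Real.add_one_le_exp _
      _ = Real.exp μ := by rw [← Real.exp_sum, hsum]
      _ ≤ 1 + 2 * μ := by
          have h := Real.abs_exp_sub_one_le (x := μ) (by rwa [abs_of_pos hμ])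
          rw [abs_of_pos hμ] at h
          linarith [le_abs_self (Real.exp μ - 1)]
  have hbern : ∑ y, (2 : ℝ) ^ (∑ i, f i (G y i)) ≤ ∑ y, ∏ i, (1 + f i (G y i)) := by
    refine sum_le_sum fun y _ => ?_
    rw [Real.rpow_sum_of_pos (by norm_num)]
    refine prod_le_prod (fun i _ => by positivity) fun i _ => ?_
    have h := rpow_one_add_le_one_add_mul_self (s := 1) (by norm_num)
      (hf i (G y i)).1 (hf i (G y i)).2
    norm_num at h
    exact h
  have h := hG f hf
  simp only [Fintype.card_fun, Fintype.card_bool, Fintype.card_fin, Nat.cast_pow,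
    Nat.cast_ofNat] at h
  rw [div_le_iff₀ (by positivity)]
  have hN : (0 : ℝ) < 2 ^ (w + ⌈L⌉₊) := by positivity
  have h3 := mul_le_mul_of_nonneg_left hmean hN.le
  linarith
end
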